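/- Let Φ be an m×m complex Hermitian positive definite matrix with largest eigenvalue λ_max and smallest eigenvalue λ_min, let 0 ≤ δ < 1, let d ≤ m, and let Ψ be a d×m complex matrix satisfying (1−δ)‖s‖² ≤ ‖Ψs‖² ≤ (1+δ)‖s‖² for every s ∈ ℂᵐ. Then Ψ Φ Ψᴴ is Hermitian positive definite, and every eigenvalue μ of (Ψ Φ Ψᴴ)⁻¹ satisfies 1/((1+δ)·λ_max) ≤ μ ≤ 1/((1−δ)·λ_min). -/

import Mathlib

open Matrix ComplexOrder

namespace Matrix

variable {n p : Type*} [Fintype n] [Fintype p]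

theorem star_dotProduct_self_eq_sum_norm_sq (w : n → ℂ) :
    star w ⬝ᵥ w = ((∑ i, ‖w i‖ ^ 2 : ℝ) : ℂ) := by
  simp [dotProduct, Complex.conj_mul']

/-- The Cauchy–Schwarz inequality for the standard Hermitian form. -/
theorem norm_star_dotProduct_sq_le (v w : n → ℂ) :
    ‖star v ⬝ᵥ w‖ ^ 2 ≤ (∑ i, ‖v i‖ ^ 2) * ∑ i, ‖w i‖ ^ 2 := by
  have h : ‖star v ⬝ᵥ w‖ ≤ ∑ i, ‖v i‖ * ‖w i‖ :=
    (norm_sum_le _ _).trans_eq (by simp)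
  calc ‖star v ⬝ᵥ w‖ ^ 2 ≤ (∑ i, ‖v i‖ * ‖w i‖) ^ 2 := by gcongr
    _ ≤ _ := Finset.sum_mul_sq_le_sq_mul_sq _ _ _

theorem star_mulVec_conjTranspose_dotProduct (A : Matrix p n ℂ) (v : p → ℂ) (s : n → ℂ) :
    star (Aᴴ *ᵥ v) ⬝ᵥ s = star v ⬝ᵥ (A *ᵥ s) := by
  rw [star_mulVec, conjTranspose_conjTranspose, dotProduct_mulVec]

/-- An upper bound for a matrix, as an operator on Euclidean space, also bounds its adjoint. -/
theorem sum_norm_sq_conjTranspose_mulVec_le {A : Matrix p n ℂ} {c : ℝ} (hc : 0 ≤ c)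
    (h : ∀ s, ∑ i, ‖(A *ᵥ s) i‖ ^ 2 ≤ c * ∑ i, ‖s i‖ ^ 2) (v : p → ℂ) :
    ∑ i, ‖(Aᴴ *ᵥ v) i‖ ^ 2 ≤ c * ∑ i, ‖v i‖ ^ 2 := by
  have hv : 0 ≤ ∑ i, ‖v i‖ ^ 2 := by positivity
  have hw : 0 ≤ ∑ i, ‖(Aᴴ *ᵥ v) i‖ ^ 2 := by positivity
  have hcs := norm_star_dotProduct_sq_le v (A *ᵥ (Aᴴ *ᵥ v))
  rw [← star_mulVec_conjTranspose_dotProduct, star_dotProduct_self_eq_sum_norm_sq,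
    Complex.norm_real, Real.norm_of_nonneg hw] at hcs
  have hA := mul_le_mul_of_nonneg_left (h (Aᴴ *ᵥ v)) hv
  rcases hw.eq_or_lt with h0 | hpos
  · rw [← h0]
    positivity
  · refine le_of_mul_le_mul_right ?_ hpos
    nlinarith

/-- A lower bound for a surjective matrix also holds for its adjoint. -/
theorem le_sum_norm_sq_conjTranspose_mulVec {A : Matrix p n ℂ} {c : ℝ}
    (hA : Function.Surjective A.mulVec)
    (h : ∀ s, c * ∑ i, ‖s i‖ ^ 2 ≤ ∑ i, ‖(A *ᵥ s) i‖ ^ 2) (v : p → ℂ) :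
    c * ∑ i, ‖v i‖ ^ 2 ≤ ∑ i, ‖(Aᴴ *ᵥ v) i‖ ^ 2 := by
  obtain ⟨s, rfl⟩ := hA v
  set v := A *ᵥ s
  have hv : 0 ≤ ∑ i, ‖v i‖ ^ 2 := by positivity
  have hw : 0 ≤ ∑ i, ‖(Aᴴ *ᵥ v) i‖ ^ 2 := by positivity
  have hcs := norm_star_dotProduct_sq_le (Aᴴ *ᵥ v) s
  rw [star_mulVec_conjTranspose_dotProduct, star_dotProduct_self_eq_sum_norm_sq,
    Complex.norm_real, Real.norm_of_nonneg hv] at hcs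
  rcases le_or_gt c 0 with hc | hc
  · exact (mul_nonpos_of_nonpos_of_nonneg hc hv).trans hw
  rcases hv.eq_or_lt with h0 | hpos
  · rwa [← h0, mul_zero]
  · refine le_of_mul_le_mul_right ?_ hpos
    nlinarith [mul_le_mul_of_nonneg_left (h s) hw, mul_le_mul_of_nonneg_left hcs hc.le]

section Rayleigh

variable [DecidableEq n] {A : Matrix n n ℂ} (hA : A.IsHermitian)

/-- The quadratic form of a Hermitian matrix in an orthonormal basis of eigenvectors. -/
theorem IsHermitian.star_dotProduct_mulVec_eq_sum_eigenvalues (w : n → ℂ) :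
    star w ⬝ᵥ (A *ᵥ w) = ((∑ i, hA.eigenvalues i *
      ‖((hA.eigenvectorUnitary : Matrix n n ℂ)ᴴ *ᵥ w) i‖ ^ 2 : ℝ) : ℂ) := by
  set U := (hA.eigenvectorUnitary : Matrix n n ℂ) with hU
  have h : A = U * diagonal (RCLike.ofReal ∘ hA.eigenvalues) * Uᴴ := by
    conv_lhs => rw [hA.spectral_theorem, Unitary.conjStarAlgAut_apply]
    rfl
  conv_lhs => rw [h]
  rw [← mulVec_mulVec, ← mulVec_mulVec, ← star_mulVec_conjTranspose_dotProduct]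
  simp only [dotProduct, mulVec_diagonal]
  push_cast
  refine Finset.sum_congr rfl fun i _ => ?_
  rw [← Complex.conj_mul']
  simp only [Pi.star_apply, Function.comp_apply, RCLike.star_def, Complex.coe_algebraMap]
  ring

theorem IsHermitian.sum_norm_sq_eigenvectorUnitary_conjTranspose_mulVec (w : n → ℂ) :
    ∑ i, ‖((hA.eigenvectorUnitary : Matrix n n ℂ)ᴴ *ᵥ w) i‖ ^ 2 = ∑ i, ‖w i‖ ^ 2 := by
  have h : (hA.eigenvectorUnitary : Matrix n n ℂ) * (hA.eigenvectorUnitary : Matrix n n ℂ)ᴴ = 1 :=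
    Unitary.coe_mul_star_self _
  apply Complex.ofReal_injective
  rw [← star_dotProduct_self_eq_sum_norm_sq, star_mulVec_conjTranspose_dotProduct,
    mulVec_mulVec, h, one_mulVec, star_dotProduct_self_eq_sum_norm_sq]

theorem IsHermitian.re_star_dotProduct_mulVec_le {b : ℝ} (hb : ∀ i, hA.eigenvalues i ≤ b)
    (w : n → ℂ) : (star w ⬝ᵥ (A *ᵥ w)).re ≤ b * ∑ i, ‖w i‖ ^ 2 := by
  rw [hA.star_dotProduct_mulVec_eq_sum_eigenvalues, Complex.ofReal_re,
    ← hA.sum_norm_sq_eigenvectorUnitary_conjTranspose_mulVec w, Finset.mul_sum]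
  gcongr with i
  exact hb i

theorem IsHermitian.le_re_star_dotProduct_mulVec {a : ℝ} (ha : ∀ i, a ≤ hA.eigenvalues i)
    (w : n → ℂ) : a * ∑ i, ‖w i‖ ^ 2 ≤ (star w ⬝ᵥ (A *ᵥ w)).re := by
  rw [hA.star_dotProduct_mulVec_eq_sum_eigenvalues, Complex.ofReal_re,
    ← hA.sum_norm_sq_eigenvectorUnitary_conjTranspose_mulVec w, Finset.mul_sum]
  gcongr with i
  exact ha i

/-- Bounds on the quadratic form of a positive definite matrix give reciprocal bounds on the
eigenvalues of its inverse. -/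
theorem PosDef.inv_eigenvalues_bounds (hA : A.PosDef) {a b : ℝ} (ha : 0 < a)
    (hlow : ∀ v : n → ℂ, a * ∑ i, ‖v i‖ ^ 2 ≤ (star v ⬝ᵥ (A *ᵥ v)).re)
    (hup : ∀ v : n → ℂ, (star v ⬝ᵥ (A *ᵥ v)).re ≤ b * ∑ i, ‖v i‖ ^ 2) (i : n) :
    1 / b ≤ hA.isHermitian.inv.eigenvalues i ∧ hA.isHermitian.inv.eigenvalues i ≤ 1 / a := by
  set μ := hA.isHermitian.inv.eigenvalues i
  set v : n → ℂ := ⇑(hA.isHermitian.inv.eigenvectorBasis i) with hv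
  have hnorm : ∑ j, ‖v j‖ ^ 2 = 1 := by
    rw [← EuclideanSpace.norm_sq_eq, OrthonormalBasis.norm_eq_one, one_pow]
  have heig : v = μ • (A *ᵥ v) := by
    have h := hA.isHermitian.inv.mulVec_eigenvectorBasis i
    rw [← mulVec_smul, ← h, mulVec_mulVec, mul_nonsing_inv _ ((isUnit_iff_isUnit_det A).1 hA.isUnit),
      one_mulVec]
  have hone : μ * (star v ⬝ᵥ (A *ᵥ v)).re = 1 := by
    have h : star v ⬝ᵥ v = μ • (star v ⬝ᵥ (A *ᵥ v)) := by
      rw [← dotProduct_smul, ← heig]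
    rw [star_dotProduct_self_eq_sum_norm_sq, hnorm] at h
    simpa using (congrArg Complex.re h).symm
  have hl := hlow v
  have hu := hup v
  rw [hnorm, mul_one] at hl hu
  have hμ : μ = 1 / (star v ⬝ᵥ (A *ᵥ v)).re := eq_one_div_of_mul_eq_one_left hone
  rw [hμ]
  exact ⟨one_div_le_one_div_of_le (ha.trans_le hl) hu, one_div_le_one_div_of_le ha hl⟩

end Rayleigh

end Matrix

/-- Let `Φ` be an `m × m` complex Hermitian positive definite matrix with
largest eigenvalue `λmax` and smallest eigenvalue `λmin`, let `0 ≤ δ < 1`, `d ≤ m`, and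
let `Ψ` be a `d × m` complex matrix satisfying the RIP-type inequality
`(1 − δ)‖s‖² ≤ ‖Ψ s‖² ≤ (1 + δ)‖s‖²` for every `s ∈ ℂᵐ` (with `‖v‖² = ∑ ‖vᵢ‖²`).
Then `Ψ Φ Ψᴴ` is Hermitian positive definite and every eigenvalue `μ` of `(Ψ Φ Ψᴴ)⁻¹`
satisfies `1/((1 + δ)·λmax) ≤ μ ≤ 1/((1 − δ)·λmin)`. -/
theorem compressed_covariance_inverse_eigenvalue_bounds {d m : ℕ} (hdm : d ≤ m)
    (Φ : Matrix (Fin m) (Fin m) ℂ) (hΦ : Φ.PosDef)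
    (lammax lammin : ℝ)
    (hmax : IsGreatest (Set.range hΦ.isHermitian.eigenvalues) lammax)
    (hmin : IsLeast (Set.range hΦ.isHermitian.eigenvalues) lammin)
    (δ : ℝ) (hδ0 : 0 ≤ δ) (hδ1 : δ < 1)
    (Ψ : Matrix (Fin d) (Fin m) ℂ)
    (hrip : ∀ s : Fin m → ℂ,
      (1 - δ) * (∑ i, ‖s i‖ ^ 2) ≤ ∑ i, ‖(Ψ *ᵥ s) i‖ ^ 2 ∧
        ∑ i, ‖(Ψ *ᵥ s) i‖ ^ 2 ≤ (1 + δ) * (∑ i, ‖s i‖ ^ 2)) :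
    ∃ hPD : (Ψ * Φ * Ψᴴ).PosDef,
      ∀ i : Fin d,
        1 / ((1 + δ) * lammax) ≤ hPD.isHermitian.inv.eigenvalues i ∧
          hPD.isHermitian.inv.eigenvalues i ≤ 1 / ((1 - δ) * lammin) := by
  have hinj : Function.Injective Ψ.mulVecLin := by
    rw [injective_iff_map_eq_zero]
    intro s hs
    have h := (hrip s).1
    rw [← mulVecLin_apply, hs] at h
    have hsum : ∑ i, ‖s i‖ ^ 2 = 0 :=
      le_antisymm (nonpos_of_mul_nonpos_right (by simpa using h) (sub_pos.2 hδ1)) (by positivity)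
    funext i
    simpa using (Finset.sum_eq_zero_iff_of_nonneg fun i _ => by positivity).1 hsum i
      (Finset.mem_univ i)
  obtain rfl : d = m :=
    hdm.antisymm (by simpa using LinearMap.finrank_le_finrank_of_injective hinj)
  have hsurj : Function.Surjective Ψ.mulVec := LinearMap.injective_iff_surjective.1 hinj
  have hunit : IsUnit Ψ := mulVec_surjective_iff_isUnit.1 hsurj
  have hPD : (Ψ * Φ * Ψᴴ).PosDef :=
    hΦ.mul_mul_conjTranspose_same (vecMul_injective_iff_isUnit.2 hunit)
  have hlmin : 0 < lammin := by
    obtain ⟨j, rfl⟩ := hmin.1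
    exact hΦ.eigenvalues_pos j
  have hlmax : 0 < lammax := by
    obtain ⟨j, rfl⟩ := hmax.1
    exact hΦ.eigenvalues_pos j
  have hform (v : Fin d → ℂ) :
      star v ⬝ᵥ ((Ψ * Φ * Ψᴴ) *ᵥ v) = star (Ψᴴ *ᵥ v) ⬝ᵥ (Φ *ᵥ (Ψᴴ *ᵥ v)) := by
    rw [star_mulVec_conjTranspose_dotProduct, mulVec_mulVec, mulVec_mulVec, mul_assoc]
  refine ⟨hPD, hPD.inv_eigenvalues_bounds (mul_pos (sub_pos.2 hδ1) hlmin) (fun v => ?_)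
    fun v => ?_⟩
  · rw [hform, mul_comm (1 - δ), mul_assoc]
    refine le_trans ?_ (hΦ.isHermitian.le_re_star_dotProduct_mulVec
      (fun j => hmin.2 (Set.mem_range_self j)) _)
    exact mul_le_mul_of_nonneg_left
      (le_sum_norm_sq_conjTranspose_mulVec hsurj (fun s => (hrip s).1) v) hlmin.le
  · rw [hform, mul_comm (1 + δ), mul_assoc]
    refine (hΦ.isHermitian.re_star_dotProduct_mulVec_le
      (fun j => hmax.2 (Set.mem_range_self j)) _).trans ?_
    exact mul_le_mul_of_nonneg_left
      (sum_norm_sq_conjTranspose_mulVec_le (by linarith) (fun s => (hrip s).2) v) hlmax.le
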